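/- Let μ₀ be a probability measure on [−1,1], Θ = [−1,1]^{ℤ²} with the product σ-algebra and product probability measure ℙ = ⊗_{ℤ²} μ₀, 𝔼 the expectation with respect to ℙ, and for γ ∈ ℤ² let T(γ) : Θ → Θ be the shift (T(γ)ω)_{γ'} = ω_{γ'+γ}. Let E = ℝ × [0,∞), and let (A_ω)_{ω∈Θ}, (B_ω)_{ω∈Θ} be families of kernels A_ω, B_ω : E × E → ℂ, jointly measurable in (ω,x,y), jointly continuous in (x,y) off the diagonal, and satisfying, uniformly in ω, |A_ω(x,y)| ≤ C (1 + |ln ‖x−y‖|) e^{−δ‖x−y‖} and |B_ω(x,y)| ≤ C (1 + ‖x−y‖^{−1}) e^{−δ‖x−y‖} for some C, δ > 0 and all x ≠ y. Assume the product covariance relation: for every γ = (γ₁,0) ∈ ℤ² and all x, y ∈ E, A_ω(x−γ, y−γ) B_ω(y−γ, x−γ) = A_{T(γ)ω}(x,y) B_{T(γ)ω}(y,x). Then for every L > 0, 𝔼( ∫_{[0,1]×[0,∞)} dx ∫_{ℝ×[0,L]} dy A_ω(x,y) B_ω(y,x) ) = 𝔼( ∫_{[0,1]×[0,L]} dy ∫_{ℝ×[0,∞)}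 dx B_ω(y,x) A_ω(x,y) ), both iterated integrals being absolutely convergent. -/

import Mathlib

open MeasureTheory Filter Set

noncomputable section

/-- The disorder configuration space `Θ = [−1,1]^{ℤ²}`, with the product σ-algebra. -/
abbrev DisorderSpace : Type := (ℤ × ℤ) → Set.Icc (-1 : ℝ) 1

/-- The shift `(T(γ)ω)_{γ'} = ω_{γ'+γ}`. -/
def disorderShift (γ : ℤ × ℤ) (ω : DisorderSpace) : DisorderSpace :=
  fun γ' => ω (γ' + γ)

/-- The Euclidean norm on `ℝ²` realized as `ℝ × ℝ`. -/
def eNorm2 (x : ℝ × ℝ) : ℝ := Real.sqrt (x.1 ^ 2 + x.2 ^ 2)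

/-- Embedding of the lattice `ℤ²` into `ℝ²`. -/
def latR2 (γ : ℤ × ℤ) : ℝ × ℝ := ((γ.1 : ℝ), (γ.2 : ℝ))

lemma disorderShift_measurable (γ : ℤ × ℤ) : Measurable (disorderShift γ) := by
  unfold disorderShift
  fun_prop

/-- The product measure is invariant under the shifts. -/
lemma disorderShift_mp (μ0 : Measure (Set.Icc (-1 : ℝ) 1)) [IsProbabilityMeasure μ0]
    (P : Measure DisorderSpace)
    (hP : ∀ (s : Finset (ℤ × ℤ)) (A : (ℤ × ℤ) → Set (Set.Icc (-1 : ℝ) 1)),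
      (∀ i ∈ s, MeasurableSet (A i)) →
        P {ω | ∀ i ∈ s, ω i ∈ A i} = ∏ i ∈ s, μ0 (A i)) (γ : ℤ × ℤ) :
    MeasurePreserving (disorderShift γ) P P := by
  refine ⟨disorderShift_measurable γ, ?_⟩
  have h1 : P = Measure.infinitePi (fun _ : ℤ × ℤ => μ0) := by
    refine Measure.eq_infinitePi _ fun s t ht => ?_
    rw [← hP s t (fun i _ => ht i)]
    rfl
  have h2 : P.map (disorderShift γ) = Measure.infinitePi (fun _ : ℤ × ℤ => μ0) := by
    refine Measure.eq_infinitePi _ fun s t ht => ?_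
    rw [Measure.map_apply (disorderShift_measurable γ)
      (MeasurableSet.pi s.countable_toSet fun i _ => ht i)]
    have := hP (s.map (Equiv.addRight γ).toEmbedding) (fun i => t (i - γ)) (fun i _ => ht _)
    simp only [Finset.prod_map, Finset.mem_map, forall_exists_index, and_imp,
      forall_apply_eq_imp_iff₂, Equiv.coe_toEmbedding, Equiv.coe_addRight, add_sub_cancel_right] at this
    rw [← this]
    rfl
  rw [h2, ← h1]

/-- The total space of disorder configurations and pairs of points. -/
def XSp : Type := DisorderSpace × ((ℝ × ℝ) × (ℝ × ℝ))

instance : MeasurableSpace XSp :=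
  inferInstanceAs (MeasurableSpace (DisorderSpace × ((ℝ × ℝ) × (ℝ × ℝ))))

/-- The diagonal action of horizontal shifts. -/
def xAct (n : ℤ) (p : DisorderSpace × ((ℝ × ℝ) × (ℝ × ℝ))) :
    DisorderSpace × ((ℝ × ℝ) × (ℝ × ℝ)) :=
  (disorderShift (n, 0) p.1, (p.2.1 + latR2 (n, 0), p.2.2 + latR2 (n, 0)))

instance : AddAction ℤ XSp where
  vadd n p := xAct n p
  zero_vadd p := by
    change xAct 0 p = p
    obtain ⟨ω, x, y⟩ := p
    have h0 : disorderShift (0, 0) ω = ω := by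
      funext i
      exact congrArg ω (add_zero i)
    simp [xAct, h0, latR2]
  add_vadd a b p := by
    change xAct (a + b) p = xAct a (xAct b p)
    obtain ⟨ω, x, y⟩ := p
    simp only [xAct, latR2, Prod.mk.injEq]
    refine ⟨?_, ?_, ?_⟩
    · funext i
      change ω (i + (a + b, 0)) = ω (i + (a, 0) + (b, 0))
      congr 1
      ext <;> simp [add_assoc]
    · ext <;> simp; ring
    · ext <;> simp; ring

lemma xAct_measurable (n : ℤ) : Measurable (xAct n) := by
  unfold xAct
  exact ((disorderShift_measurable _).comp measurable_fst).prodMk (by fun_prop)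

instance : MeasurableConstVAdd ℤ XSp where
  measurable_const_vadd n := xAct_measurable n

lemma xAct_mp (P : Measure DisorderSpace) [IsProbabilityMeasure P]
    (hP : ∀ γ, MeasurePreserving (disorderShift γ) P P) (n : ℤ) :
    MeasurePreserving (xAct n) (P.prod (volume.prod volume)) (P.prod (volume.prod volume)) := by
  have h : MeasurePreserving (fun x : ℝ × ℝ => x + latR2 (n, 0)) volume volume :=
    measurePreserving_add_right _ _
  exact (hP (n, 0)).prod (h.prod h)

lemma unfold_aux {E : Type*} [NormedAddCommGroup E] [NormedSpace ℝ E]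
    (P : Measure DisorderSpace) [IsProbabilityMeasure P]
    (hP : ∀ γ, MeasurePreserving (disorderShift γ) P P)
    (f : DisorderSpace × ((ℝ × ℝ) × (ℝ × ℝ)) → E) (hf : ∀ n p, f (xAct n p) = f p) :
    (IntegrableOn f {p | p.2.1.1 ∈ Ioc (0 : ℝ) 1} (P.prod (volume.prod volume)) ↔
      IntegrableOn f {p | p.2.2.1 ∈ Ioc (0 : ℝ) 1} (P.prod (volume.prod volume))) ∧
    ∫ p in {p | p.2.1.1 ∈ Ioc (0 : ℝ) 1}, f p ∂(P.prod (volume.prod volume)) =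
      ∫ p in {p | p.2.2.1 ∈ Ioc (0 : ℝ) 1}, f p ∂(P.prod (volume.prod volume)) := by
  let m : Measure XSp := P.prod (volume.prod volume)
  have : VAddInvariantMeasure ℤ XSp m :=
    ⟨fun n s hs => (xAct_mp P hP n).measure_preimage hs.nullMeasurableSet⟩
  have key : ∀ a : ℝ, ∃! n : ℤ, a + n ∈ Ioc (0 : ℝ) 1 := by
    intro a
    simpa using existsUnique_add_zsmul_mem_Ioc (zero_lt_one' ℝ) a 0
  have hs : IsAddFundamentalDomain ℤ
      ({p | p.2.1.1 ∈ Ioc (0 : ℝ) 1} : Set (DisorderSpace × ((ℝ × ℝ) × (ℝ × ℝ)))) (α := XSp) m := by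
    refine IsAddFundamentalDomain.mk' (MeasurableSet.nullMeasurableSet ?_) fun p => key p.2.1.1
    exact (measurable_fst.comp (measurable_fst.comp measurable_snd)) measurableSet_Ioc
  have ht : IsAddFundamentalDomain ℤ
      ({p | p.2.2.1 ∈ Ioc (0 : ℝ) 1} : Set (DisorderSpace × ((ℝ × ℝ) × (ℝ × ℝ)))) (α := XSp) m := by
    refine IsAddFundamentalDomain.mk' (MeasurableSet.nullMeasurableSet ?_) fun p => key p.2.2.1
    exact (measurable_fst.comp (measurable_snd.comp measurable_snd)) measurableSet_Ioc
  exact ⟨hs.integrableOn_iff ht (f := f) hf, hs.setIntegral_eq ht (f := f) hf⟩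

/-- First integration region. -/
abbrev regS (L : ℝ) : Set ((ℝ × ℝ) × (ℝ × ℝ)) :=
  (Set.Icc (0:ℝ) 1 ×ˢ Set.Ici (0:ℝ)) ×ˢ ((Set.univ : Set ℝ) ×ˢ Set.Icc (0:ℝ) L)

/-- Second integration region. -/
abbrev regT (L : ℝ) : Set ((ℝ × ℝ) × (ℝ × ℝ)) :=
  ((Set.univ : Set ℝ) ×ˢ Set.Ici (0:ℝ)) ×ˢ (Set.Icc (0:ℝ) 1 ×ˢ Set.Icc (0:ℝ) L)

lemma unfold_main {E : Type*} [NormedAddCommGroup E] [NormedSpace ℝ E]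
    (P : Measure DisorderSpace) [IsProbabilityMeasure P]
    (hP : ∀ γ, MeasurePreserving (disorderShift γ) P P) (L : ℝ)
    (f : DisorderSpace × ((ℝ × ℝ) × (ℝ × ℝ)) → E)
    (hf : ∀ n p, 0 ≤ p.2.1.2 → 0 ≤ p.2.2.2 → f (xAct n p) = f p) :
    (IntegrableOn f (univ ×ˢ regS L) (P.prod (volume.prod volume)) ↔
      IntegrableOn f (univ ×ˢ regT L) (P.prod (volume.prod volume))) ∧
    ∫ p in univ ×ˢ regS L, f p ∂(P.prod (volume.prod volume)) =
      ∫ p in univ ×ˢ regT L, f p ∂(P.prod (volume.prod volume)) := by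
  let R : Set (DisorderSpace × ((ℝ × ℝ) × (ℝ × ℝ))) :=
    univ ×ˢ (((univ : Set ℝ) ×ˢ Ici (0 : ℝ)) ×ˢ ((univ : Set ℝ) ×ˢ Icc (0 : ℝ) L))
  have hR : MeasurableSet R := by
    exact MeasurableSet.univ.prod ((MeasurableSet.univ.prod measurableSet_Ici).prod
      (MeasurableSet.univ.prod measurableSet_Icc))
  have hS : ({p | p.2.1.1 ∈ Ioc (0 : ℝ) 1} ∩ R : Set (DisorderSpace × ((ℝ × ℝ) × (ℝ × ℝ))))
      =ᵐ[P.prod (volume.prod volume)] univ ×ˢ regS L := by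
    have : ({p | p.2.1.1 ∈ Ioc (0 : ℝ) 1} ∩ R : Set (DisorderSpace × ((ℝ × ℝ) × (ℝ × ℝ))))
        = univ ×ˢ ((Ioc (0 : ℝ) 1 ×ˢ Ici (0:ℝ)) ×ˢ ((Set.univ : Set ℝ) ×ˢ Set.Icc (0:ℝ) L)) := by
      ext ⟨ω, x, y⟩
      simp [R]
      tauto
    rw [this]
    refine Measure.set_prod_ae_eq (ae_eq_refl _) (Measure.set_prod_ae_eq ?_ (ae_eq_refl _))
    exact Measure.set_prod_ae_eq Ioc_ae_eq_Icc (ae_eq_refl _)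
  have hT : ({p | p.2.2.1 ∈ Ioc (0 : ℝ) 1} ∩ R : Set (DisorderSpace × ((ℝ × ℝ) × (ℝ × ℝ))))
      =ᵐ[P.prod (volume.prod volume)] univ ×ˢ regT L := by
    have : ({p | p.2.2.1 ∈ Ioc (0 : ℝ) 1} ∩ R : Set (DisorderSpace × ((ℝ × ℝ) × (ℝ × ℝ))))
        = univ ×ˢ (((Set.univ : Set ℝ) ×ˢ Ici (0:ℝ)) ×ˢ (Ioc (0 : ℝ) 1 ×ˢ Set.Icc (0:ℝ) L)) := by
      ext ⟨ω, x, y⟩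
      simp [R]
      tauto
    rw [this]
    refine Measure.set_prod_ae_eq (ae_eq_refl _) (Measure.set_prod_ae_eq (ae_eq_refl _) ?_)
    exact Measure.set_prod_ae_eq Ioc_ae_eq_Icc (ae_eq_refl _)
  have h := unfold_aux P hP (R.indicator f) (by
    intro n p
    have h1 : xAct n p ∈ R ↔ p ∈ R := by
      simp [R, xAct, latR2]
    by_cases hp : p ∈ R
    · rw [indicator_of_mem (h1.2 hp), indicator_of_mem hp]
      simp only [R, mem_prod, mem_univ, true_and, mem_Ici, mem_Icc] at hp
      exact hf n p hp.1 hp.2.1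
    · rw [indicator_of_notMem (fun h => hp (h1.1 h)), indicator_of_notMem hp])
  rw [setIntegral_indicator hR, setIntegral_indicator hR, setIntegral_congr_set hS,
    setIntegral_congr_set hT, integrableOn_indicator_iff hR, integrableOn_indicator_iff hR,
    inter_comm R, inter_comm R, integrableOn_congr_set_ae hS, integrableOn_congr_set_ae hT] at h
  exact h

/-- The radial majorant. -/
def majo (δ r : ℝ) : ℝ := (10 + 2 / δ + 7 * r ^ (-(3/2) : ℝ)) * Real.exp (-δ * r)

lemma majo_integrable {δ : ℝ} (hδ : 0 < δ) :
    Integrable (fun z : ℝ × ℝ => majo δ ‖z‖) volume := by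
  have : (volume : Measure (ℝ × ℝ)).IsAddHaarMeasure :=
    inferInstanceAs ((volume : Measure ℝ).prod (volume : Measure ℝ)).IsAddHaarMeasure
  rw [integrable_fun_norm_addHaar volume (f := majo δ)]
  have h1 := (integrableOn_rpow_mul_exp_neg_mul_rpow (s := 1) (p := 1) (by norm_num)
    one_pos hδ).const_mul (10 + 2 / δ)
  have h2 := (integrableOn_rpow_mul_exp_neg_mul_rpow (s := -(1/2)) (p := 1) (by norm_num)
    one_pos hδ).const_mul 7
  refine (h1.add h2).congr ?_
  filter_upwards [ae_restrict_mem measurableSet_Ioi] with r hr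
  have hr : 0 < r := hr
  have : r ^ (-(1/2) : ℝ) = r * r ^ (-(3/2) : ℝ) := by
    nth_rw 2 [← Real.rpow_one r]
    rw [← Real.rpow_add hr]
    norm_num
  simp [majo] at this ⊢
  rw [this]
  ring

lemma majo_bound {δ r : ℝ} (hδ : 0 < δ) (hr : 0 < r) :
    (1 + |Real.log r|) * (1 + r⁻¹) * Real.exp (-δ * r) * Real.exp (-δ * r) ≤ majo δ r := by
  obtain ⟨s, hs, rfl⟩ : ∃ s, 0 < s ∧ r = s ^ 2 := ⟨√r, Real.sqrt_pos.2 hr, (Real.sq_sqrt hr.le).symm⟩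
  have e1 : (s ^ 2 : ℝ) ^ (-(3/2) : ℝ) = s⁻¹ ^ 3 := by
    rw [← Real.rpow_natCast, ← Real.rpow_mul hs.le, ← Real.rpow_natCast, Real.inv_rpow hs.le,
      ← Real.rpow_neg hs.le]
    norm_num
  have hl : |Real.log (s ^ 2)| ≤ 2 * (1 + s ^ 2) + 2 * s⁻¹ := by
    have a1 := Real.log_le_sub_one_of_pos hs
    have a2 := Real.log_le_sub_one_of_pos (inv_pos.2 hs)
    have a3 := inv_pos.2 hs
    rw [Real.log_inv] at a2
    rw [Real.log_pow, abs_le]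
    push_cast
    constructor <;> nlinarith [sq_nonneg (s - 1)]
  have he : s ^ 2 * Real.exp (-δ * s ^ 2) ≤ 1 / δ := by
    rw [le_div_iff₀ hδ]
    have := Real.add_one_le_exp (δ * s ^ 2)
    rw [neg_mul, Real.exp_neg]
    have hp := Real.exp_pos (δ * s ^ 2)
    rw [← div_eq_mul_inv, div_mul_eq_mul_div, div_le_one hp]
    linarith
  have he1 : Real.exp (-δ * s ^ 2) ≤ 1 := by
    rw [Real.exp_le_one_iff]
    nlinarith [sq_nonneg s]
  have hp := Real.exp_pos (-δ * s ^ 2)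
  unfold majo
  rw [e1]
  gcongr
  set e := Real.exp (-δ * s ^ 2)
  have hu : 0 < s⁻¹ := inv_pos.2 hs
  have hmul : s * s⁻¹ = 1 := mul_inv_cancel₀ hs.ne'
  set u := s⁻¹
  have hs2 : (s ^ 2)⁻¹ = u ^ 2 := (inv_pow s 2).symm
  rw [hs2]
  have hsu : s ^ 2 * u ^ 2 = 1 := by rw [← mul_pow, hmul, one_pow]
  have hstep : (1 + |Real.log (s ^ 2)|) * (1 + u ^ 2) ≤ 2 * s ^ 2 + (10 + 7 * u ^ 3) := by
    calc _ ≤ (1 + (2 * (1 + s ^ 2) + 2 * u)) * (1 + u ^ 2) := by gcongr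
      _ = 2 * s ^ 2 + (3 + 2 * u + 3 * u ^ 2 + 2 * (s ^ 2 * u ^ 2) + 2 * u ^ 3) := by ring
      _ ≤ _ := by
        rw [hsu]
        have b1 : u ≤ 1 + u ^ 3 := by nlinarith [sq_nonneg (u - 1), sq_nonneg (u + 1), pow_pos hu 3]
        have b2 : u ^ 2 ≤ 1 + u ^ 3 := by
          rcases le_total u 1 with h | h
          · nlinarith [pow_pos hu 3]
          · nlinarith [pow_pos hu 2]
        linarith
  have hu3 := pow_pos hu 3
  calc _ ≤ (2 * s ^ 2 + (10 + 7 * u ^ 3)) * e := by gcongr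
    _ = 2 * (s ^ 2 * e) + (10 + 7 * u ^ 3) * e := by ring
    _ ≤ 2 * (1 / δ) + (10 + 7 * u ^ 3) * 1 := by gcongr
    _ = _ := by ring

lemma majo_anti {δ a b : ℝ} (hδ : 0 < δ) (ha : 0 < a) (hab : a ≤ b) : majo δ b ≤ majo δ a := by
  unfold majo
  have : b ^ (-(3/2) : ℝ) ≤ a ^ (-(3/2) : ℝ) :=
    Real.rpow_le_rpow_of_nonpos ha hab (by norm_num)
  have : 0 ≤ b ^ (-(3/2) : ℝ) := Real.rpow_nonneg (ha.le.trans hab) _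
  have : 0 ≤ a ^ (-(3/2) : ℝ) := Real.rpow_nonneg ha.le _
  have h1 : -δ * b ≤ -δ * a := by nlinarith
  gcongr

lemma norm_le_eNorm2 (z : ℝ × ℝ) : ‖z‖ ≤ eNorm2 z := by
  unfold eNorm2
  rw [Prod.norm_def]
  refine max_le ?_ ?_
  · rw [Real.norm_eq_abs]
    exact Real.abs_le_sqrt (by nlinarith [sq_nonneg z.2])
  · rw [Real.norm_eq_abs]
    exact Real.abs_le_sqrt (by nlinarith [sq_nonneg z.1])

lemma majo_integrableOn_T {δ : ℝ} (hδ : 0 < δ) (L : ℝ) :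
    IntegrableOn (fun q : (ℝ × ℝ) × (ℝ × ℝ) => majo δ ‖q.1 - q.2‖) (regT L)
      (volume.prod volume) := by
  have h : IntegrableOn (fun q : (ℝ × ℝ) × (ℝ × ℝ) => majo δ ‖q.1 - q.2‖)
      (univ ×ˢ (Set.Icc (0:ℝ) 1 ×ˢ Set.Icc (0:ℝ) L)) (volume.prod volume) := by
    rw [IntegrableOn, ← Measure.prod_restrict, Measure.restrict_univ]
    have : IsFiniteMeasure ((volume : Measure (ℝ × ℝ)).restrict
        (Set.Icc (0:ℝ) 1 ×ˢ Set.Icc (0:ℝ) L)) :=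
      isFiniteMeasure_restrict.2 (isCompact_Icc.prod isCompact_Icc).measure_lt_top.ne
    have h1 := (majo_integrable hδ).comp_snd ((volume : Measure (ℝ × ℝ)).restrict
        (Set.Icc (0:ℝ) 1 ×ˢ Set.Icc (0:ℝ) L))
    have h2 := (measurePreserving_prod_neg_add_swap (volume : Measure (ℝ × ℝ))
      ((volume : Measure (ℝ × ℝ)).restrict (Set.Icc (0:ℝ) 1 ×ˢ Set.Icc (0:ℝ) L))).integrable_comp_of_integrable h1
    refine h2.congr (Eventually.of_forall fun q => ?_)
    simp [neg_add_eq_sub]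
  exact h.mono_set (prod_mono (subset_univ _) subset_rfl)

lemma ae_offdiag : ∀ᵐ q : (ℝ × ℝ) × (ℝ × ℝ) ∂(volume.prod volume), q.1 ≠ q.2 := by
  have hm : MeasurableSet {q : (ℝ × ℝ) × (ℝ × ℝ) | q.1 ≠ q.2} :=
    (measurableSet_eq_fun measurable_fst measurable_snd).compl
  rw [Measure.ae_prod_iff_ae_ae hm]
  refine Eventually.of_forall fun x => ?_
  filter_upwards [(measure_eq_zero_iff_ae_notMem.1 (measure_singleton x : volume {x} = 0))] with y hy
  exact fun h => hy h.symm

/-- **Generalized trace cyclicity, half-plane version.**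
For kernels on `E = ℝ × [0,∞)` with logarithmic/inverse-distance singularities on the
diagonal, exponential off-diagonal decay, and a covariant product with respect to the
horizontal lattice shifts, the disorder expectation of the iterated integral
`∫_{[0,1]×[0,∞)} dx ∫_{ℝ×[0,L]} dy A_ω(x,y) B_ω(y,x)` equals that of
`∫_{[0,1]×[0,L]} dy ∫_{ℝ×[0,∞)} dx B_ω(y,x) A_ω(x,y)`, both being absolutely convergent. -/
theorem generalized_trace_cyclicity_edge
    (μ0 : Measure (Set.Icc (-1 : ℝ) 1)) [IsProbabilityMeasure μ0]
    (P : Measure DisorderSpace) [IsProbabilityMeasure P]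
    -- `P` is the product measure `⊗_{ℤ²} μ0`, characterized by its cylinder probabilities:
    (hP : ∀ (s : Finset (ℤ × ℤ)) (A : (ℤ × ℤ) → Set (Set.Icc (-1 : ℝ) 1)),
      (∀ i ∈ s, MeasurableSet (A i)) →
        P {ω | ∀ i ∈ s, ω i ∈ A i} = ∏ i ∈ s, μ0 (A i))
    (A B : DisorderSpace → (ℝ × ℝ) → (ℝ × ℝ) → ℂ)
    (hAmeas : Measurable (fun p : DisorderSpace × (ℝ × ℝ) × (ℝ × ℝ) => A p.1 p.2.1 p.2.2))
    (hBmeas : Measurable (fun p : DisorderSpace × (ℝ × ℝ) × (ℝ × ℝ) => B p.1 p.2.1 p.2.2))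
    (hAcont : ∀ ω, ContinuousOn (fun p : (ℝ × ℝ) × (ℝ × ℝ) => A ω p.1 p.2)
      {p : (ℝ × ℝ) × (ℝ × ℝ) | p.1 ∈ (Set.univ ×ˢ Set.Ici (0:ℝ)) ∧
        p.2 ∈ (Set.univ ×ˢ Set.Ici (0:ℝ)) ∧ p.1 ≠ p.2})
    (hBcont : ∀ ω, ContinuousOn (fun p : (ℝ × ℝ) × (ℝ × ℝ) => B ω p.1 p.2)
      {p : (ℝ × ℝ) × (ℝ × ℝ) | p.1 ∈ (Set.univ ×ˢ Set.Ici (0:ℝ)) ∧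
        p.2 ∈ (Set.univ ×ˢ Set.Ici (0:ℝ)) ∧ p.1 ≠ p.2})
    (C δ : ℝ) (hC : 0 < C) (hδ : 0 < δ)
    (hAbound : ∀ ω, ∀ x ∈ (Set.univ ×ˢ Set.Ici (0:ℝ)), ∀ y ∈ (Set.univ ×ˢ Set.Ici (0:ℝ)),
      x ≠ y → ‖A ω x y‖ ≤ C * (1 + |Real.log (eNorm2 (x - y))|) * Real.exp (-δ * eNorm2 (x - y)))
    (hBbound : ∀ ω, ∀ x ∈ (Set.univ ×ˢ Set.Ici (0:ℝ)), ∀ y ∈ (Set.univ ×ˢ Set.Ici (0:ℝ)),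
      x ≠ y → ‖B ω x y‖ ≤ C * (1 + (eNorm2 (x - y))⁻¹) * Real.exp (-δ * eNorm2 (x - y)))
    -- covariance of the product under horizontal lattice shifts:
    (hcov : ∀ γ₁ : ℤ, ∀ ω, ∀ x ∈ (Set.univ ×ˢ Set.Ici (0:ℝ)), ∀ y ∈ (Set.univ ×ˢ Set.Ici (0:ℝ)),
      A ω (x - latR2 (γ₁, 0)) (y - latR2 (γ₁, 0)) * B ω (y - latR2 (γ₁, 0)) (x - latR2 (γ₁, 0))
        = A (disorderShift (γ₁, 0) ω) x y * B (disorderShift (γ₁, 0) ω) y x)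
    (L : ℝ) (hL : 0 < L) :
    (∀ ω, IntegrableOn (fun q : (ℝ × ℝ) × (ℝ × ℝ) => A ω q.1 q.2 * B ω q.2 q.1)
        ((Set.Icc (0:ℝ) 1 ×ˢ Set.Ici (0:ℝ)) ×ˢ ((Set.univ : Set ℝ) ×ˢ Set.Icc (0:ℝ) L))) ∧
    (∀ ω, IntegrableOn (fun q : (ℝ × ℝ) × (ℝ × ℝ) => B ω q.1 q.2 * A ω q.2 q.1)
        ((Set.Icc (0:ℝ) 1 ×ˢ Set.Icc (0:ℝ) L) ×ˢ ((Set.univ : Set ℝ) ×ˢ Set.Ici (0:ℝ)))) ∧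
    (∫ ω, (∫ x in (Set.Icc (0:ℝ) 1 ×ˢ Set.Ici (0:ℝ)),
        ∫ y in ((Set.univ : Set ℝ) ×ˢ Set.Icc (0:ℝ) L), A ω x y * B ω y x) ∂P)
      = ∫ ω, (∫ y in (Set.Icc (0:ℝ) 1 ×ˢ Set.Icc (0:ℝ) L),
        ∫ x in ((Set.univ : Set ℝ) ×ˢ Set.Ici (0:ℝ)), B ω y x * A ω x y) ∂P := by
  have hsh := disorderShift_mp μ0 P hP
  set F : DisorderSpace × ((ℝ × ℝ) × (ℝ × ℝ)) → ℂ :=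
    fun p => A p.1 p.2.1 p.2.2 * B p.1 p.2.2 p.2.1 with hF
  have hFm : Measurable F := by
    refine hAmeas.mul (hBmeas.comp (f := fun p : DisorderSpace × ((ℝ × ℝ) × (ℝ × ℝ)) =>
      (p.1, p.2.2, p.2.1)) ?_)
    fun_prop
  have hFinv : ∀ n p, 0 ≤ p.2.1.2 → 0 ≤ p.2.2.2 → F (xAct n p) = F p := by
    rintro n ⟨ω, x, y⟩ hx hy
    have := hcov n ω (x + latR2 (n, 0)) (by simpa [latR2] using hx)
      (y + latR2 (n, 0)) (by simpa [latR2] using hy)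
    simp only [add_sub_cancel_right] at this
    exact this.symm
  have hbd : ∀ ω (x y : ℝ × ℝ), 0 ≤ x.2 → 0 ≤ y.2 → x ≠ y →
      ‖F (ω, x, y)‖ ≤ C ^ 2 * majo δ ‖x - y‖ := by
    intro ω x y hx hy hxy
    have a1 := hAbound ω x (by simpa using hx) y (by simpa using hy) hxy
    have a2 := hBbound ω y (by simpa using hy) x (by simpa using hx) hxy.symm
    have e : eNorm2 (y - x) = eNorm2 (x - y) := by
      simp only [eNorm2, Prod.fst_sub, Prod.snd_sub]
      congr 1
      ring
    rw [e] at a2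
    have hpos : 0 < ‖x - y‖ := norm_pos_iff.2 (sub_ne_zero.2 hxy)
    have hle := norm_le_eNorm2 (x - y)
    have hpos' := hpos.trans_le hle
    rw [hF]
    simp only [norm_mul]
    calc _ ≤ (C * (1 + |Real.log (eNorm2 (x - y))|) * Real.exp (-δ * eNorm2 (x - y))) *
          (C * (1 + (eNorm2 (x - y))⁻¹) * Real.exp (-δ * eNorm2 (x - y))) := by gcongr
      _ = C ^ 2 * ((1 + |Real.log (eNorm2 (x - y))|) * (1 + (eNorm2 (x - y))⁻¹) *
          Real.exp (-δ * eNorm2 (x - y)) * Real.exp (-δ * eNorm2 (x - y))) := by ring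
      _ ≤ C ^ 2 * majo δ (eNorm2 (x - y)) := by
        gcongr
        exact majo_bound hδ hpos'
      _ ≤ _ := by
        gcongr
        exact majo_anti hδ hpos hle
  have hSm : MeasurableSet (regS L) := (measurableSet_Icc.prod measurableSet_Ici).prod
    (MeasurableSet.univ.prod measurableSet_Icc)
  have hTm : MeasurableSet (regT L) := (MeasurableSet.univ.prod measurableSet_Ici).prod
    (measurableSet_Icc.prod measurableSet_Icc)
  have hprod : ∀ s : Set ((ℝ × ℝ) × (ℝ × ℝ)),
      (P.prod ((volume : Measure (ℝ × ℝ)).prod (volume : Measure (ℝ × ℝ)))).restrict (univ ×ˢ s) =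
      P.prod ((volume.prod volume).restrict s) := by
    intro s
    rw [← Measure.prod_restrict, Measure.restrict_univ]
  -- the majorant
  have hGT := majo_integrableOn_T hδ L
  have hPne : P ≠ 0 := IsProbabilityMeasure.ne_zero P
  have hGS : IntegrableOn (fun q : (ℝ × ℝ) × (ℝ × ℝ) => majo δ ‖q.1 - q.2‖) (regS L)
      (volume.prod volume) := by
    have h := (unfold_main P hsh L (fun p => majo δ ‖p.2.1 - p.2.2‖) (by
      intro n p _ _
      simp [xAct])).1
    simp only [IntegrableOn, hprod] at h
    exact (Integrable.comp_snd_iff hPne).1 (h.2 (hGT.comp_snd P))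
  have hsec : ∀ (s : Set ((ℝ × ℝ) × (ℝ × ℝ))), MeasurableSet s →
      (∀ q ∈ s, 0 ≤ q.1.2 ∧ 0 ≤ q.2.2) →
      IntegrableOn (fun q : (ℝ × ℝ) × (ℝ × ℝ) => majo δ ‖q.1 - q.2‖) s (volume.prod volume) →
      (∀ ω, IntegrableOn (fun q => F (ω, q)) s (volume.prod volume)) ∧
      Integrable F (P.prod ((volume.prod volume).restrict s)) := by
    intro s hs hpos hG
    have hae : ∀ᵐ q ∂((volume : Measure (ℝ × ℝ)).prod (volume : Measure (ℝ × ℝ))).restrict s,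
        ∀ ω, ‖F (ω, q)‖ ≤ C ^ 2 * majo δ ‖q.1 - q.2‖ := by
      filter_upwards [ae_restrict_of_ae ae_offdiag, ae_restrict_mem hs] with q hq hqs ω
      exact hbd ω q.1 q.2 (hpos q hqs).1 (hpos q hqs).2 hq
    refine ⟨fun ω => ?_, ?_⟩
    · refine Integrable.mono' (hG.const_mul (C ^ 2)) ?_ (hae.mono fun q hq => hq ω)
      exact (hFm.comp measurable_prodMk_left).aestronglyMeasurable
    · refine Integrable.mono' ((hG.const_mul (C ^ 2)).comp_snd P) hFm.aestronglyMeasurable ?_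
      have := (Measure.quasiMeasurePreserving_snd (μ := P)
        (ν := (volume.prod volume).restrict s)).ae hae
      exact this.mono fun p hp => hp p.1
  obtain ⟨hS1, hS2⟩ := hsec (regS L) hSm (by
    rintro ⟨x, y⟩ ⟨hx, hy⟩
    exact ⟨hx.2, hy.2.1⟩) hGS
  obtain ⟨hT1, hT2⟩ := hsec (regT L) hTm (by
    rintro ⟨x, y⟩ ⟨hx, hy⟩
    exact ⟨hx.2, hy.2.1⟩) hGT
  have hT1' : ∀ ω, IntegrableOn (fun q : (ℝ × ℝ) × (ℝ × ℝ) => B ω q.1 q.2 * A ω q.2 q.1)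
        ((Set.Icc (0:ℝ) 1 ×ˢ Set.Icc (0:ℝ) L) ×ˢ ((Set.univ : Set ℝ) ×ˢ Set.Ici (0:ℝ)))
        (volume.prod volume) := by
    intro ω
    refine (hT1 ω).swap.congr (Eventually.of_forall fun q => ?_)
    simp [hF, mul_comm]
  refine ⟨hS1, hT1', ?_⟩
  have hmain := (unfold_main P hsh L F hFinv).2
  rw [hprod, hprod, integral_prod _ hS2, integral_prod _ hT2] at hmain
  have hl : ∀ ω, (∫ x in (Set.Icc (0:ℝ) 1 ×ˢ Set.Ici (0:ℝ)),
        ∫ y in ((Set.univ : Set ℝ) ×ˢ Set.Icc (0:ℝ) L), A ω x y * B ω y x) =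
      ∫ q in regS L, F (ω, q) ∂(volume.prod volume) := by
    intro ω
    rw [setIntegral_prod _ (hS1 ω)]
  have hr : ∀ ω, (∫ y in (Set.Icc (0:ℝ) 1 ×ˢ Set.Icc (0:ℝ) L),
        ∫ x in ((Set.univ : Set ℝ) ×ˢ Set.Ici (0:ℝ)), B ω y x * A ω x y) =
      ∫ q in regT L, F (ω, q) ∂(volume.prod volume) := by
    intro ω
    rw [← setIntegral_prod_swap]
    have := setIntegral_prod _ (hT1' ω)
    rw [← this]
    refine integral_congr_ae (Eventually.of_forall fun q => ?_)
    simp [hF, mul_comm]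
  simp_rw [hl, hr]
  exact hmain

end
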